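/- arXiv:1508.06713 — 2 statements merged into one kernel-verified Lean document; each statement's English description precedes it below -/
import Mathlib

section
/- Let X, M, N be SF-normal forms and O be S or F, and suppose O X M N →_SF R. Then for every one-hole context C of Curryfied Applicative SF-calculus, the reduction sequence from C[⟦O X M N⟧_@] to C[⟦R⟧_@] is perpetual; in particular, if C[⟦O X M N⟧_@] admits an infinite →_{SF@} reduction sequence, then so does C[⟦R⟧_@]. -/
/-- Terms of SF-calculus: two atoms `S` and `F` and binary application. -/
inductive SF where
  | S : SF
  | F : SF
  | app : SF → SF → SF

/-- Factorable forms: partially applied combinators. -/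
def SF.Factorable : SF → Prop
  | .S => True
  | .F => True
  | .app .S _ => True
  | .app .F _ => True
  | .app (.app .S _) _ => True
  | .app (.app .F _) _ => True
  | _ => False

/-- One-step reduction of SF-calculus, closed under contexts. -/
inductive SF.Red : SF → SF → Prop
  | sred (M N X : SF) :
      SF.Red (app (app (app S M) N) X) (app (app M X) (app N X))
  | fatomS (M N : SF) : SF.Red (app (app (app F S) M) N) M
  | fatomF (M N : SF) : SF.Red (app (app (app F F) M) N) M
  | fcomp (P Q M N : SF) : (SF.app P Q).Factorable →
      SF.Red (app (app (app F (app P Q)) M) N) (app (app N P) Q)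
  | appL {M M' : SF} (N : SF) : SF.Red M M' → SF.Red (app M N) (app M' N)
  | appR (M : SF) {N N' : SF} : SF.Red N N' → SF.Red (app M N) (app M N')

/-- An SF-normal form: a term admitting no reduction step. -/
def SF.NormalForm (M : SF) : Prop := ¬ ∃ N : SF, SF.Red M N

/-- Terms of Curryfied Applicative SF-calculus: constructors `S0`, `F0`
(nullary), `S1`, `F1` (unary), `S2`, `F2` (binary), and program symbols
`app` (binary) and `fRed` (f-reduce, ternary). -/
inductive SFA where
  | S0 : SFA
  | F0 : SFA
  | S1 : SFA → SFA
  | F1 : SFA → SFA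
  | S2 : SFA → SFA → SFA
  | F2 : SFA → SFA → SFA
  | app : SFA → SFA → SFA
  | fRed : SFA → SFA → SFA → SFA

/-- One-step reduction of Curryfied Applicative SF-calculus: the contextual
closure of the twelve rewrite rules. -/
inductive SFA.Red : SFA → SFA → Prop
  | appS0 (x : SFA) : SFA.Red (app S0 x) (S1 x)
  | appS1 (x y : SFA) : SFA.Red (app (S1 x) y) (S2 x y)
  | appS2 (x y z : SFA) : SFA.Red (app (S2 x y) z) (app (app x z) (app y z))
  | appF0 (x : SFA) : SFA.Red (app F0 x) (F1 x)
  | appF1 (x y : SFA) : SFA.Red (app (F1 x) y) (F2 x y)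
  | appF2 (x y z : SFA) : SFA.Red (app (F2 x y) z) (fRed x y z)
  | fRedS0 (y z : SFA) : SFA.Red (fRed S0 y z) y
  | fRedF0 (y z : SFA) : SFA.Red (fRed F0 y z) y
  | fRedS1 (x y z : SFA) : SFA.Red (fRed (S1 x) y z) (app (app z S0) x)
  | fRedF1 (x y z : SFA) : SFA.Red (fRed (F1 x) y z) (app (app z F0) x)
  | fRedS2 (p q y z : SFA) : SFA.Red (fRed (S2 p q) y z) (app (app z (app S0 p)) q)
  | fRedF2 (p q y z : SFA) : SFA.Red (fRed (F2 p q) y z) (app (app z (app F0 p)) q)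
  | s1C {a a' : SFA} : SFA.Red a a' → SFA.Red (S1 a) (S1 a')
  | f1C {a a' : SFA} : SFA.Red a a' → SFA.Red (F1 a) (F1 a')
  | s2L {a a' : SFA} (b : SFA) : SFA.Red a a' → SFA.Red (S2 a b) (S2 a' b)
  | s2R (a : SFA) {b b' : SFA} : SFA.Red b b' → SFA.Red (S2 a b) (S2 a b')
  | f2L {a a' : SFA} (b : SFA) : SFA.Red a a' → SFA.Red (F2 a b) (F2 a' b)
  | f2R (a : SFA) {b b' : SFA} : SFA.Red b b' → SFA.Red (F2 a b) (F2 a b')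
  | appL {a a' : SFA} (b : SFA) : SFA.Red a a' → SFA.Red (app a b) (app a' b)
  | appR (a : SFA) {b b' : SFA} : SFA.Red b b' → SFA.Red (app a b) (app a b')
  | fRed1 {a a' : SFA} (b c : SFA) : SFA.Red a a' → SFA.Red (fRed a b c) (fRed a' b c)
  | fRed2 (a : SFA) {b b' : SFA} (c : SFA) : SFA.Red b b' → SFA.Red (fRed a b c) (fRed a b' c)
  | fRed3 (a b : SFA) {c c' : SFA} : SFA.Red c c' → SFA.Red (fRed a b c) (fRed a b c')

/-- The translation `⟦·⟧_@` from SF-calculus to Curryfied Applicative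
SF-calculus: `⟦S⟧ = S0`, `⟦F⟧ = F0`, `⟦M N⟧ = app ⟦M⟧ ⟦N⟧`. -/
def SF.toSFA : SF → SFA
  | .S => .S0
  | .F => .F0
  | .app M N => .app M.toSFA N.toSFA

/-- One-hole contexts of Curryfied Applicative SF-calculus. -/
inductive Ctx where
  | hole : Ctx
  | s1 : Ctx → Ctx
  | f1 : Ctx → Ctx
  | s2L : Ctx → SFA → Ctx
  | s2R : SFA → Ctx → Ctx
  | f2L : Ctx → SFA → Ctx
  | f2R : SFA → Ctx → Ctx
  | appL : Ctx → SFA → Ctx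
  | appR : SFA → Ctx → Ctx
  | fRed1 : Ctx → SFA → SFA → Ctx
  | fRed2 : SFA → Ctx → SFA → Ctx
  | fRed3 : SFA → SFA → Ctx → Ctx

/-- Filling the hole of a context with a term. -/
def Ctx.fill : Ctx → SFA → SFA
  | .hole, t => t
  | .s1 c, t => .S1 (c.fill t)
  | .f1 c, t => .F1 (c.fill t)
  | .s2L c b, t => .S2 (c.fill t) b
  | .s2R a c, t => .S2 a (c.fill t)
  | .f2L c b, t => .F2 (c.fill t) b
  | .f2R a c, t => .F2 a (c.fill t)
  | .appL c b, t => .app (c.fill t) b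
  | .appR a c, t => .app a (c.fill t)
  | .fRed1 c b d, t => .fRed (c.fill t) b d
  | .fRed2 a c d, t => .fRed a (c.fill t) d
  | .fRed3 a b c, t => .fRed a b (c.fill t)

/-- A term admits an infinite reduction sequence w.r.t. `r`. -/
def HasInf {α : Type*} (r : α → α → Prop) (a : α) : Prop :=
  ∃ f : ℕ → α, f 0 = a ∧ ∀ n, r (f n) (f (n + 1))

namespace SFA

/-- Every reduction sequence from `t` has length at most `n`. -/
def BddRed : ℕ → SFA → Prop
  | 0, t => ∀ t', ¬ Red t t'
  | n + 1, t => ∀ t', Red t t' → BddRed n t'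

theorem BddRed.step {n : ℕ} {t t' : SFA} (h : BddRed n t) (r : Red t t') :
    ∃ m < n, BddRed m t' := by
  cases n with
  | zero => exact (h _ r).elim
  | succ m => exact ⟨m, m.lt_succ_self, h _ r⟩

/-- Contraction of a root redex whose erased argument, if any, has reduction sequences of length
at most the index. -/
inductive Root : ℕ → SFA → SFA → Prop
  | appS0 (x : SFA) : Root 0 (app S0 x) (S1 x)
  | appS1 (x y : SFA) : Root 0 (app (S1 x) y) (S2 x y)
  | appS2 (x y z : SFA) : Root 0 (app (S2 x y) z) (app (app x z) (app y z))
  | appF0 (x : SFA) : Root 0 (app F0 x) (F1 x)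
  | appF1 (x y : SFA) : Root 0 (app (F1 x) y) (F2 x y)
  | appF2 (x y z : SFA) : Root 0 (app (F2 x y) z) (fRed x y z)
  | fRedS0 {k : ℕ} (y : SFA) {z : SFA} : BddRed k z → Root k (fRed S0 y z) y
  | fRedF0 {k : ℕ} (y : SFA) {z : SFA} : BddRed k z → Root k (fRed F0 y z) y
  | fRedS1 {k : ℕ} (x : SFA) {y : SFA} (z : SFA) : BddRed k y →
      Root k (fRed (S1 x) y z) (app (app z S0) x)
  | fRedF1 {k : ℕ} (x : SFA) {y : SFA} (z : SFA) : BddRed k y →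
      Root k (fRed (F1 x) y z) (app (app z F0) x)
  | fRedS2 {k : ℕ} (p q : SFA) {y : SFA} (z : SFA) : BddRed k y →
      Root k (fRed (S2 p q) y z) (app (app z (app S0 p)) q)
  | fRedF2 {k : ℕ} (p q : SFA) {y : SFA} (z : SFA) : BddRed k y →
      Root k (fRed (F2 p q) y z) (app (app z (app F0 p)) q)

theorem Root.red {k : ℕ} {t s : SFA} (h : Root k t s) : Red t s := by
  cases h <;> constructor

theorem Root.step {k : ℕ} {t s t' : SFA} (h : Root k t s) (r : Red t t') :
    t' = s ∨ (∃ k' s', Root k' t' s' ∧ Relation.TransGen Red s s') ∨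
      ∃ k' < k, Root k' t' s := by
  cases h with
  | appS0 x =>
    cases r with
    | appS0 => exact .inl rfl
    | appL _ r => cases r
    | appR _ r => exact .inr (.inl ⟨_, _, .appS0 _, .single (.s1C r)⟩)
  | appF0 x =>
    cases r with
    | appF0 => exact .inl rfl
    | appL _ r => cases r
    | appR _ r => exact .inr (.inl ⟨_, _, .appF0 _, .single (.f1C r)⟩)
  | appS1 x y =>
    cases r with
    | appS1 => exact .inl rfl
    | appL _ r =>
      cases r with
      | s1C r => exact .inr (.inl ⟨_, _, .appS1 _ _, .single (.s2L _ r)⟩)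
    | appR _ r => exact .inr (.inl ⟨_, _, .appS1 _ _, .single (.s2R _ r)⟩)
  | appF1 x y =>
    cases r with
    | appF1 => exact .inl rfl
    | appL _ r =>
      cases r with
      | f1C r => exact .inr (.inl ⟨_, _, .appF1 _ _, .single (.f2L _ r)⟩)
    | appR _ r => exact .inr (.inl ⟨_, _, .appF1 _ _, .single (.f2R _ r)⟩)
  | appS2 x y z =>
    cases r with
    | appS2 => exact .inl rfl
    | appL _ r =>
      cases r with
      | s2L _ r => exact .inr (.inl ⟨_, _, .appS2 _ _ _, .single (.appL _ (.appL _ r))⟩)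
      | s2R _ r => exact .inr (.inl ⟨_, _, .appS2 _ _ _, .single (.appR _ (.appL _ r))⟩)
    | appR _ r =>
      exact .inr (.inl ⟨_, _, .appS2 _ _ _,
        .tail (.single (.appL _ (.appR _ r))) (.appR _ (.appR _ r))⟩)
  | appF2 x y z =>
    cases r with
    | appF2 => exact .inl rfl
    | appL _ r =>
      cases r with
      | f2L _ r => exact .inr (.inl ⟨_, _, .appF2 _ _ _, .single (.fRed1 _ _ r)⟩)
      | f2R _ r => exact .inr (.inl ⟨_, _, .appF2 _ _ _, .single (.fRed2 _ _ r)⟩)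
    | appR _ r => exact .inr (.inl ⟨_, _, .appF2 _ _ _, .single (.fRed3 _ _ r)⟩)
  | fRedS0 y hz =>
    cases r with
    | fRedS0 => exact .inl rfl
    | fRed1 _ _ r => cases r
    | fRed2 _ _ r => exact .inr (.inl ⟨_, _, .fRedS0 _ hz, .single r⟩)
    | fRed3 _ _ r =>
      obtain ⟨m, hm, hb⟩ := hz.step r
      exact .inr (.inr ⟨m, hm, .fRedS0 _ hb⟩)
  | fRedF0 y hz =>
    cases r with
    | fRedF0 => exact .inl rfl
    | fRed1 _ _ r => cases r
    | fRed2 _ _ r => exact .inr (.inl ⟨_, _, .fRedF0 _ hz, .single r⟩)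
    | fRed3 _ _ r =>
      obtain ⟨m, hm, hb⟩ := hz.step r
      exact .inr (.inr ⟨m, hm, .fRedF0 _ hb⟩)
  | fRedS1 x z hy =>
    cases r with
    | fRedS1 => exact .inl rfl
    | fRed1 _ _ r =>
      cases r with
      | s1C r => exact .inr (.inl ⟨_, _, .fRedS1 _ _ hy, .single (.appR _ r)⟩)
    | fRed2 _ _ r =>
      obtain ⟨m, hm, hb⟩ := hy.step r
      exact .inr (.inr ⟨m, hm, .fRedS1 _ _ hb⟩)
    | fRed3 _ _ r => exact .inr (.inl ⟨_, _, .fRedS1 _ _ hy, .single (.appL _ (.appL _ r))⟩)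
  | fRedF1 x z hy =>
    cases r with
    | fRedF1 => exact .inl rfl
    | fRed1 _ _ r =>
      cases r with
      | f1C r => exact .inr (.inl ⟨_, _, .fRedF1 _ _ hy, .single (.appR _ r)⟩)
    | fRed2 _ _ r =>
      obtain ⟨m, hm, hb⟩ := hy.step r
      exact .inr (.inr ⟨m, hm, .fRedF1 _ _ hb⟩)
    | fRed3 _ _ r => exact .inr (.inl ⟨_, _, .fRedF1 _ _ hy, .single (.appL _ (.appL _ r))⟩)
  | fRedS2 p q z hy =>
    cases r with
    | fRedS2 => exact .inl rfl
    | fRed1 _ _ r =>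
      cases r with
      | s2L _ r =>
        exact .inr (.inl ⟨_, _, .fRedS2 _ _ _ hy, .single (.appL _ (.appR _ (.appR _ r)))⟩)
      | s2R _ r => exact .inr (.inl ⟨_, _, .fRedS2 _ _ _ hy, .single (.appR _ r)⟩)
    | fRed2 _ _ r =>
      obtain ⟨m, hm, hb⟩ := hy.step r
      exact .inr (.inr ⟨m, hm, .fRedS2 _ _ _ hb⟩)
    | fRed3 _ _ r => exact .inr (.inl ⟨_, _, .fRedS2 _ _ _ hy, .single (.appL _ (.appL _ r))⟩)
  | fRedF2 p q z hy =>
    cases r with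
    | fRedF2 => exact .inl rfl
    | fRed1 _ _ r =>
      cases r with
      | f2L _ r =>
        exact .inr (.inl ⟨_, _, .fRedF2 _ _ _ hy, .single (.appL _ (.appR _ (.appR _ r)))⟩)
      | f2R _ r => exact .inr (.inl ⟨_, _, .fRedF2 _ _ _ hy, .single (.appR _ r)⟩)
    | fRed2 _ _ r =>
      obtain ⟨m, hm, hb⟩ := hy.step r
      exact .inr (.inr ⟨m, hm, .fRedF2 _ _ _ hb⟩)
    | fRed3 _ _ r => exact .inr (.inl ⟨_, _, .fRedF2 _ _ _ hy, .single (.appL _ (.appL _ r))⟩)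

/-- Contraction of a set of disjoint redexes, all of whose erased arguments are of bounded
reduction length. The index bounds the number of successive steps from the source that leave the
target unchanged. -/
inductive Par : ℕ → SFA → SFA → Prop
  | root {k : ℕ} {t s : SFA} : Root k t s → Par (k + 1) t s
  | S0 : Par 0 S0 S0
  | F0 : Par 0 F0 F0
  | S1 {n : ℕ} {a a' : SFA} : Par n a a' → Par n (S1 a) (S1 a')
  | F1 {n : ℕ} {a a' : SFA} : Par n a a' → Par n (F1 a) (F1 a')
  | S2 {n m : ℕ} {a a' b b' : SFA} : Par n a a' → Par m b b' → Par (n + m) (S2 a b) (S2 a' b')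
  | F2 {n m : ℕ} {a a' b b' : SFA} : Par n a a' → Par m b b' → Par (n + m) (F2 a b) (F2 a' b')
  | app {n m : ℕ} {a a' b b' : SFA} : Par n a a' → Par m b b' →
      Par (n + m) (app a b) (app a' b')
  | fRed {n m l : ℕ} {a a' b b' c c' : SFA} : Par n a a' → Par m b b' → Par l c c' →
      Par (n + m + l) (fRed a b c) (fRed a' b' c')

theorem Par.refl (t : SFA) : Par 0 t t := by
  induction t with
  | S0 => exact .S0
  | F0 => exact .F0
  | S1 _ h => exact .S1 h
  | F1 _ h => exact .F1 h
  | S2 _ _ h₁ h₂ => exact .S2 h₁ h₂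
  | F2 _ _ h₁ h₂ => exact .F2 h₁ h₂
  | app _ _ h₁ h₂ => exact .app h₁ h₂
  | fRed _ _ _ h₁ h₂ h₃ => exact .fRed h₁ h₂ h₃

/-- A step from the source of `Par n _ s` to `t'` is simulated by at least one step from `s`, or
leaves `s` unchanged and decreases the index. -/
def Simulated (n : ℕ) (t' s : SFA) : Prop :=
  (∃ n' s', Relation.TransGen Red s s' ∧ Par n' t' s') ∨ ∃ n' < n, Par n' t' s

theorem Simulated.of_red {n m : ℕ} {t' s s' : SFA} (r : Red s s') (h : Par m t' s') :
    Simulated n t' s :=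
  .inl ⟨m, s', .single r, h⟩

theorem Simulated.congr {n N m : ℕ} {t' s : SFA} (h : Simulated n t' s) (f g : SFA → SFA)
    (hg : ∀ a b, Red a b → Red (g a) (g b))
    (hp : ∀ k b, Par k t' b → Par (k + m) (f t') (g b)) (hN : N = n + m) :
    Simulated N (f t') (g s) := by
  subst hN
  rcases h with ⟨n', s', r, h⟩ | ⟨n', hn, h⟩
  · exact .inl ⟨_, _, r.lift g hg, hp _ _ h⟩
  · exact .inr ⟨n' + m, by omega, hp _ _ h⟩

theorem Par.step {n : ℕ} {t s t' : SFA} (h : Par n t s) (r : Red t t') : Simulated n t' s := by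
  induction h generalizing t' with
  | root h =>
    rcases h.step r with rfl | ⟨k', s', h', hs⟩ | ⟨k', hk, h'⟩
    · exact .inr ⟨0, by omega, .refl _⟩
    · exact .inl ⟨_, s', hs, .root h'⟩
    · exact .inr ⟨_, by omega, .root h'⟩
  | S0 => cases r
  | F0 => cases r
  | S1 _ ih =>
    cases r with
    | s1C r => exact (ih r).congr (m := 0) .S1 .S1 (fun _ _ => .s1C) (fun _ _ h => .S1 h) rfl
  | F1 _ ih =>
    cases r with
    | f1C r => exact (ih r).congr (m := 0) .F1 .F1 (fun _ _ => .f1C) (fun _ _ h => .F1 h) rfl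
  | S2 ha hb iha ihb =>
    cases r with
    | s2L _ r =>
      exact (iha r).congr (.S2 · _) (.S2 · _) (fun _ _ => .s2L _) (fun _ _ h => .S2 h hb) rfl
    | s2R _ r =>
      exact (ihb r).congr (.S2 _) (.S2 _) (fun _ _ => .s2R _)
        (fun _ _ h => Nat.add_comm _ _ ▸ .S2 ha h) (Nat.add_comm _ _)
  | F2 ha hb iha ihb =>
    cases r with
    | f2L _ r =>
      exact (iha r).congr (.F2 · _) (.F2 · _) (fun _ _ => .f2L _) (fun _ _ h => .F2 h hb) rfl
    | f2R _ r =>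
      exact (ihb r).congr (.F2 _) (.F2 _) (fun _ _ => .f2R _)
        (fun _ _ h => Nat.add_comm _ _ ▸ .F2 ha h) (Nat.add_comm _ _)
  | app ha hb iha ihb =>
    cases r with
    | appL _ r =>
      exact (iha r).congr (.app · _) (.app · _) (fun _ _ => .appL _) (fun _ _ h => .app h hb) rfl
    | appR _ r =>
      exact (ihb r).congr (.app _) (.app _) (fun _ _ => .appR _)
        (fun _ _ h => Nat.add_comm _ _ ▸ .app ha h) (Nat.add_comm _ _)
    | appS0 =>
      cases ha with
      | root h => cases h
      | S0 => exact .of_red (.appS0 _) (.S1 hb)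
    | appF0 =>
      cases ha with
      | root h => cases h
      | F0 => exact .of_red (.appF0 _) (.F1 hb)
    | appS1 =>
      cases ha with
      | root h => cases h
      | S1 hx => exact .of_red (.appS1 _ _) (.S2 hx hb)
    | appF1 =>
      cases ha with
      | root h => cases h
      | F1 hx => exact .of_red (.appF1 _ _) (.F2 hx hb)
    | appS2 =>
      cases ha with
      | root h => cases h
      | S2 hx hy => exact .of_red (.appS2 _ _ _) (.app (.app hx hb) (.app hy hb))
    | appF2 =>
      cases ha with
      | root h => cases h
      | F2 hx hy => exact .of_red (.appF2 _ _ _) (.fRed hx hy hb)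
  | @fRed n m l _ _ _ _ _ _ ha hb hc iha ihb ihc =>
    cases r with
    | fRed1 _ _ r =>
      exact (iha r).congr (.fRed · _ _) (.fRed · _ _) (fun _ _ => .fRed1 _ _)
        (fun _ _ h => Nat.add_assoc _ _ _ ▸ .fRed h hb hc) (Nat.add_assoc _ _ _)
    | fRed2 _ _ r =>
      exact (ihb r).congr (m := n + l) (.fRed _ · _) (.fRed _ · _) (fun _ _ => .fRed2 _ _)
        (fun _ _ h => Nat.add_left_comm _ _ _ ▸ Nat.add_assoc _ _ _ ▸ .fRed ha h hc) (by omega)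
    | fRed3 _ _ r =>
      exact (ihc r).congr (.fRed _ _) (.fRed _ _) (fun _ _ => .fRed3 _ _)
        (fun _ _ h => Nat.add_comm _ _ ▸ .fRed ha hb h) (Nat.add_comm _ _)
    | fRedS0 =>
      cases ha with
      | root h => cases h
      | S0 => exact .of_red (.fRedS0 _ _) hb
    | fRedF0 =>
      cases ha with
      | root h => cases h
      | F0 => exact .of_red (.fRedF0 _ _) hb
    | fRedS1 =>
      cases ha with
      | root h => cases h
      | S1 hx => exact .of_red (.fRedS1 _ _ _) (.app (.app hc .S0) hx)
    | fRedF1 =>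
      cases ha with
      | root h => cases h
      | F1 hx => exact .of_red (.fRedF1 _ _ _) (.app (.app hc .F0) hx)
    | fRedS2 =>
      cases ha with
      | root h => cases h
      | S2 hp hq => exact .of_red (.fRedS2 _ _ _ _) (.app (.app hc (.app .S0 hp)) hq)
    | fRedF2 =>
      cases ha with
      | root h => cases h
      | F2 hp hq => exact .of_red (.fRedF2 _ _ _ _) (.app (.app hc (.app .F0 hp)) hq)

theorem Par.acc {n : ℕ} {t s : SFA} (h : Par n t s) (hs : Acc (flip Red) s) :
    Acc (flip Red) t := by
  have hs' : Acc (Relation.TransGen (flip Red)) s := hs.transGen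
  induction hs' generalizing n t with
  | intro s _ ih =>
    induction n using Nat.strong_induction_on generalizing t with
    | _ n ihn =>
      refine ⟨_, fun t' r => ?_⟩
      rcases h.step r with ⟨n', s', hs', h'⟩ | ⟨n', hn, h'⟩
      · have hs' : Relation.TransGen (flip Red) s' s := Relation.transGen_swap.2 hs'
        exact ih s' hs' h' (hs.inv_of_transGen hs')
      · exact ihn n' hn h'

theorem hasInf_iff_not_acc {t : SFA} : HasInf Red t ↔ ¬ Acc (flip Red) t := by
  rw [not_acc_iff_exists_descending_chain]
  rfl

/-- A reduction step that is perpetual because whatever it erases is of bounded reduction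
length. -/
def SafeRed (t s : SFA) : Prop := Red t s ∧ ∃ n, Par n t s

theorem SafeRed.hasInf {t s : SFA} (h : SafeRed t s) (ht : HasInf Red t) : HasInf Red s := by
  obtain ⟨-, n, hp⟩ := h
  rw [hasInf_iff_not_acc] at ht ⊢
  exact fun hs => ht (hp.acc hs)

theorem Root.safeRed {k : ℕ} {t s : SFA} (h : Root k t s) : SafeRed t s :=
  ⟨h.red, _, .root h⟩

theorem SafeRed.appL {a a' : SFA} (b : SFA) (h : SafeRed a a') : SafeRed (app a b) (app a' b) :=
  ⟨.appL b h.1, h.2.imp fun _ h => .app h (.refl b)⟩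

theorem SafeRed.fRed1 {a a' : SFA} (b c : SFA) (h : SafeRed a a') :
    SafeRed (fRed a b c) (fRed a' b c) :=
  ⟨.fRed1 b c h.1, h.2.imp fun _ h => .fRed h (.refl b) (.refl c)⟩

theorem SafeRed.fill {t s : SFA} (h : SafeRed t s) (C : Ctx) : SafeRed (C.fill t) (C.fill s) := by
  induction C with
  | hole => exact h
  | s1 _ ih => exact ⟨.s1C ih.1, ih.2.imp fun _ h => .S1 h⟩
  | f1 _ ih => exact ⟨.f1C ih.1, ih.2.imp fun _ h => .F1 h⟩
  | s2L _ b ih => exact ⟨.s2L b ih.1, ih.2.imp fun _ h => .S2 h (.refl b)⟩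
  | s2R a _ ih =>
    obtain ⟨r, n, h⟩ := ih
    exact ⟨.s2R a r, _, .S2 (.refl a) h⟩
  | f2L _ b ih => exact ⟨.f2L b ih.1, ih.2.imp fun _ h => .F2 h (.refl b)⟩
  | f2R a _ ih =>
    obtain ⟨r, n, h⟩ := ih
    exact ⟨.f2R a r, _, .F2 (.refl a) h⟩
  | appL _ b ih => exact ih.appL b
  | appR a _ ih =>
    obtain ⟨r, n, h⟩ := ih
    exact ⟨.appR a r, _, .app (.refl a) h⟩
  | fRed1 _ b c ih => exact ih.fRed1 b c
  | fRed2 a _ c ih =>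
    obtain ⟨r, n, h⟩ := ih
    exact ⟨.fRed2 a c r, _, .fRed (.refl a) h (.refl c)⟩
  | fRed3 a b _ ih =>
    obtain ⟨r, n, h⟩ := ih
    exact ⟨.fRed3 a b r, _, .fRed (.refl a) (.refl b) h⟩

/-- Classification of the reducts of translated normal forms: `val n` for combinators expecting
`n` more arguments before being saturated, `free n` for combinators `F` whose first argument is
stuck and which expect `n` more arguments, and `stuck` for terms that never reach a constructor. -/
inductive Kind where
  | val : ℕ → Kind
  | free : ℕ → Kind
  | stuck : Kind

/-- The reducts of translated normal forms. -/
inductive Inert : Kind → SFA → Prop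
  | S0 : Inert (.val 2) S0
  | F0 : Inert (.val 2) F0
  | S1 {k : Kind} {a : SFA} : Inert k a → Inert (.val 1) (S1 a)
  | F1 {k : Kind} {a : SFA} : Inert k a → Inert (.val 1) (F1 a)
  | S2 {k l : Kind} {a b : SFA} : Inert k a → Inert l b → Inert (.val 0) (S2 a b)
  | F2 {k l : Kind} {a b : SFA} : Inert k a → Inert l b → Inert (.val 0) (F2 a b)
  | appVal {n : ℕ} {k : Kind} {a b : SFA} : Inert (.val (n + 1)) a → Inert k b →
      Inert (.val n) (app a b)
  | freeF1 {a : SFA} : Inert .stuck a → Inert (.free 1) (F1 a)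
  | freeF2 {k : Kind} {a b : SFA} : Inert .stuck a → Inert k b → Inert (.free 0) (F2 a b)
  | appF0 {a : SFA} : Inert .stuck a → Inert (.free 1) (app F0 a)
  | appFree {k : Kind} {a b : SFA} : Inert (.free 1) a → Inert k b → Inert (.free 0) (app a b)
  | appFreeStuck {k : Kind} {a b : SFA} : Inert (.free 0) a → Inert k b →
      Inert .stuck (app a b)
  | appStuck {k : Kind} {a b : SFA} : Inert .stuck a → Inert k b → Inert .stuck (app a b)
  | fRed {k l : Kind} {a b c : SFA} : Inert .stuck a → Inert k b → Inert l c →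
      Inert .stuck (fRed a b c)

/-- The number of occurrences of `app` in a term. -/
def appCount : SFA → ℕ
  | S0 => 0
  | F0 => 0
  | S1 a => a.appCount
  | F1 a => a.appCount
  | S2 a b => a.appCount + b.appCount
  | F2 a b => a.appCount + b.appCount
  | app a b => a.appCount + b.appCount + 1
  | fRed a b c => a.appCount + b.appCount + c.appCount

theorem Inert.step {k : Kind} {t t' : SFA} (h : Inert k t) (r : Red t t') :
    Inert k t' ∧ t'.appCount < t.appCount := by
  induction h generalizing t' with
  | S0 => cases r
  | F0 => cases r
  | S1 _ ih =>
    cases r with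
    | s1C r => exact ⟨.S1 (ih r).1, (ih r).2⟩
  | F1 _ ih =>
    cases r with
    | f1C r => exact ⟨.F1 (ih r).1, (ih r).2⟩
  | S2 ha hb iha ihb =>
    cases r with
    | s2L _ r => exact ⟨.S2 (iha r).1 hb, Nat.add_lt_add_right (iha r).2 _⟩
    | s2R _ r => exact ⟨.S2 ha (ihb r).1, Nat.add_lt_add_left (ihb r).2 _⟩
  | F2 ha hb iha ihb =>
    cases r with
    | f2L _ r => exact ⟨.F2 (iha r).1 hb, Nat.add_lt_add_right (iha r).2 _⟩
    | f2R _ r => exact ⟨.F2 ha (ihb r).1, Nat.add_lt_add_left (ihb r).2 _⟩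
  | appVal ha hb iha ihb =>
    cases r with
    | appL _ r => exact ⟨.appVal (iha r).1 hb, by simpa [appCount] using (iha r).2⟩
    | appR _ r => exact ⟨.appVal ha (ihb r).1, by simpa [appCount] using (ihb r).2⟩
    | appS0 => cases ha; exact ⟨.S1 hb, by simp [appCount]⟩
    | appF0 => cases ha; exact ⟨.F1 hb, by simp [appCount]⟩
    | appS1 => cases ha with | S1 hx => exact ⟨.S2 hx hb, by simp [appCount]⟩
    | appF1 => cases ha with | F1 hx => exact ⟨.F2 hx hb, by simp [appCount]⟩
    | appS2 => cases ha
    | appF2 => cases ha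
  | freeF1 _ ih =>
    cases r with
    | f1C r => exact ⟨.freeF1 (ih r).1, (ih r).2⟩
  | freeF2 ha hb iha ihb =>
    cases r with
    | f2L _ r => exact ⟨.freeF2 (iha r).1 hb, Nat.add_lt_add_right (iha r).2 _⟩
    | f2R _ r => exact ⟨.freeF2 ha (ihb r).1, Nat.add_lt_add_left (ihb r).2 _⟩
  | appF0 ha ih =>
    cases r with
    | appL _ r => cases r
    | appR _ r => exact ⟨.appF0 (ih r).1, by simpa [appCount] using (ih r).2⟩
    | appF0 => exact ⟨.freeF1 ha, by simp [appCount]⟩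
  | appFree ha hb iha ihb =>
    cases r with
    | appL _ r => exact ⟨.appFree (iha r).1 hb, by simpa [appCount] using (iha r).2⟩
    | appR _ r => exact ⟨.appFree ha (ihb r).1, by simpa [appCount] using (ihb r).2⟩
    | appF1 => cases ha with | freeF1 hx => exact ⟨.freeF2 hx hb, by simp [appCount]⟩
    | _ => cases ha
  | appFreeStuck ha hb iha ihb =>
    cases r with
    | appL _ r => exact ⟨.appFreeStuck (iha r).1 hb, by simpa [appCount] using (iha r).2⟩
    | appR _ r => exact ⟨.appFreeStuck ha (ihb r).1, by simpa [appCount] using (ihb r).2⟩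
    | appF2 => cases ha with | freeF2 hx hy => exact ⟨.fRed hx hy hb, by simp [appCount]⟩
    | _ => cases ha
  | appStuck ha hb iha ihb =>
    cases r with
    | appL _ r => exact ⟨.appStuck (iha r).1 hb, by simpa [appCount] using (iha r).2⟩
    | appR _ r => exact ⟨.appStuck ha (ihb r).1, by simpa [appCount] using (ihb r).2⟩
    | _ => cases ha
  | fRed ha hb hc iha ihb ihc =>
    cases r with
    | fRed1 _ _ r => exact ⟨.fRed (iha r).1 hb hc, by simpa [appCount] using (iha r).2⟩
    | fRed2 _ _ r => exact ⟨.fRed ha (ihb r).1 hc, by simpa [appCount] using (ihb r).2⟩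
    | fRed3 _ _ r => exact ⟨.fRed ha hb (ihc r).1, by simpa [appCount] using (ihc r).2⟩
    | _ => cases ha

theorem Inert.bddRed {k : Kind} {t : SFA} (h : Inert k t) : BddRed t.appCount t := by
  suffices ∀ n, ∀ t, Inert k t → t.appCount ≤ n → BddRed n t from this _ t h le_rfl
  intro n
  induction n with
  | zero =>
    intro t h hn t' r
    have := (h.step r).2
    omega
  | succ n ih =>
    intro t h hn t' r
    have := h.step r
    exact ih t' this.1 (by omega)

end SFA

namespace SF

theorem NormalForm.of_appL {M N : SF} (h : (app M N).NormalForm) : M.NormalForm :=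
  fun ⟨_, r⟩ => h ⟨_, .appL N r⟩

theorem NormalForm.of_appR {M N : SF} (h : (app M N).NormalForm) : N.NormalForm :=
  fun ⟨_, r⟩ => h ⟨_, .appR M r⟩

theorem Factorable.exists_red {M : SF} (h : M.Factorable) (N P : SF) :
    ∃ R, Red (app (app (app F M) N) P) R := by
  match M with
  | S => exact ⟨_, .fatomS _ _⟩
  | F => exact ⟨_, .fatomF _ _⟩
  | app _ _ => exact ⟨_, .fcomp _ _ _ _ h⟩

theorem NormalForm.inert : {M : SF} → M.NormalForm →
    (M.Factorable ∧ ∃ k, SFA.Inert k M.toSFA) ∨ SFA.Inert .stuck M.toSFA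
  | S, _ => .inl ⟨trivial, _, .S0⟩
  | F, _ => .inl ⟨trivial, _, .F0⟩
  | app P Q, h => by
    obtain ⟨l, hQ⟩ : ∃ l, SFA.Inert l Q.toSFA := by
      rcases h.of_appR.inert with h | h
      exacts [h.2, ⟨_, h⟩]
    rcases h.of_appL.inert with ⟨hf, -⟩ | hs
    · match P with
      | S => exact .inl ⟨trivial, _, .appVal .S0 hQ⟩
      | F => exact .inl ⟨trivial, _, .appVal .F0 hQ⟩
      | app S A =>
        obtain ⟨k, hA⟩ : ∃ l, SFA.Inert l A.toSFA := by
          rcases h.of_appL.of_appR.inert with h | h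
          exacts [h.2, ⟨_, h⟩]
        exact .inl ⟨trivial, _, .appVal (.appVal .S0 hA) hQ⟩
      | app F A =>
        obtain ⟨k, hA⟩ : ∃ l, SFA.Inert l A.toSFA := by
          rcases h.of_appL.of_appR.inert with h | h
          exacts [h.2, ⟨_, h⟩]
        exact .inl ⟨trivial, _, .appVal (.appVal .F0 hA) hQ⟩
      | app (app S A) B => exact (h ⟨_, .sred _ _ _⟩).elim
      | app (app F A) B =>
        obtain ⟨k, hB⟩ : ∃ l, SFA.Inert l B.toSFA := by
          rcases h.of_appL.of_appR.inert with h | h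
          exacts [h.2, ⟨_, h⟩]
        rcases h.of_appL.of_appL.of_appR.inert with ⟨hA, -⟩ | hA
        · exact (h (hA.exists_red _ _)).elim
        · exact .inr (.appFreeStuck (.appFree (.appF0 hA) hB) hQ)
    · exact .inr (.appStuck hs hQ)
termination_by M => sizeOf M

theorem NormalForm.bddRed {M : SF} (h : M.NormalForm) : ∃ n, SFA.BddRed n M.toSFA := by
  rcases h.inert with ⟨-, _, h⟩ | h
  exacts [⟨_, h.bddRed⟩, ⟨_, h.bddRed⟩]

theorem Red.safeRed_of_head {O X M N R : SF} (hO : O = S ∨ O = F) (hX : X.NormalForm)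
    (hM : M.NormalForm) (hN : N.NormalForm) (h : Red (app (app (app O X) M) N) R) :
    Relation.ReflTransGen SFA.SafeRed (app (app (app O X) M) N).toSFA R.toSFA := by
  obtain ⟨m, hm⟩ := hM.bddRed
  obtain ⟨n, hn⟩ := hN.bddRed
  have hF : Relation.ReflTransGen SFA.SafeRed (app (app (app F X) M) N).toSFA
      (.fRed X.toSFA M.toSFA N.toSFA) :=
    .head ((SFA.Root.appF0 _).safeRed.appL _ |>.appL _) <|
      .head ((SFA.Root.appF1 _ _).safeRed.appL _) <| .single (SFA.Root.appF2 _ _ _).safeRed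
  cases h with
  | sred =>
    exact .head ((SFA.Root.appS0 _).safeRed.appL _ |>.appL _) <|
      .head ((SFA.Root.appS1 _ _).safeRed.appL _) <| .single (SFA.Root.appS2 _ _ _).safeRed
  | fatomS => exact hF.tail (SFA.Root.fRedS0 _ hn).safeRed
  | fatomF => exact hF.tail (SFA.Root.fRedF0 _ hn).safeRed
  | fcomp P Q _ _ hf =>
    refine hF.trans ?_
    match P with
    | S =>
      exact .head ((SFA.Root.appS0 _).safeRed.fRed1 _ _) <|
        .single (SFA.Root.fRedS1 _ _ hm).safeRed
    | F =>
      exact .head ((SFA.Root.appF0 _).safeRed.fRed1 _ _) <|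
        .single (SFA.Root.fRedF1 _ _ hm).safeRed
    | app S A =>
      exact .head ((SFA.Root.appS0 _).safeRed.appL _ |>.fRed1 _ _) <|
        .head ((SFA.Root.appS1 _ _).safeRed.fRed1 _ _) <|
        .single (SFA.Root.fRedS2 _ _ _ hm).safeRed
    | app F A =>
      exact .head ((SFA.Root.appF0 _).safeRed.appL _ |>.fRed1 _ _) <|
        .head ((SFA.Root.appF1 _ _).safeRed.fRed1 _ _) <|
        .single (SFA.Root.fRedF2 _ _ _ hm).safeRed
  | appR _ r => exact (hN ⟨_, r⟩).elim
  | appL _ r =>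
    cases r with
    | appR _ r => exact (hM ⟨_, r⟩).elim
    | appL _ r =>
      cases r with
      | appR _ r => exact (hX ⟨_, r⟩).elim
      | appL _ r => rcases hO with rfl | rfl <;> cases r
      | _ => simp at hO
    | _ => simp at hO

end SF

theorem Relation.ReflTransGen.exists_seq {α : Type*} {r : α → α → Prop} {a b : α}
    (h : Relation.ReflTransGen r a b) :
    ∃ (n : ℕ) (g : ℕ → α), g 0 = a ∧ g n = b ∧ ∀ i < n, r (g i) (g (i + 1)) := by
  induction h using Relation.ReflTransGen.head_induction_on with
  | refl => exact ⟨0, fun _ => b, rfl, rfl, by simp⟩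
  | @head a c hac _ ih =>
    obtain ⟨n, g, h0, hn, hg⟩ := ih
    refine ⟨n + 1, fun i => Nat.casesOn i a g, rfl, hn, fun i hi => ?_⟩
    cases i with
    | zero => simpa [h0] using hac
    | succ i => exact hg i (by omega)

/-- Let `X`, `M`, `N` be SF-normal forms, `O` be `S` or `F`, and suppose
`O X M N →_SF R`.  Then for every one-hole context `C` of Curryfied Applicative
SF-calculus there is a reduction sequence from `C[⟦O X M N⟧_@]` to `C[⟦R⟧_@]`
every step of which is perpetual (preserves the existence of an infinite
reduction sequence); in particular, if `C[⟦O X M N⟧_@]` admits an infinite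
`→_{SF@}` reduction sequence, then so does `C[⟦R⟧_@]`. -/
theorem perpetual_simulation (O X M N R : SF)
    (hO : O = SF.S ∨ O = SF.F)
    (hX : X.NormalForm) (hM : M.NormalForm) (hN : N.NormalForm)
    (hstep : SF.Red (SF.app (SF.app (SF.app O X) M) N) R) (C : Ctx) :
    (∃ (n : ℕ) (g : ℕ → SFA),
        g 0 = C.fill (SF.app (SF.app (SF.app O X) M) N).toSFA ∧
        g n = C.fill R.toSFA ∧
        ∀ i < n, SFA.Red (g i) (g (i + 1)) ∧
          (HasInf SFA.Red (g i) → HasInf SFA.Red (g (i + 1)))) ∧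
    (HasInf SFA.Red (C.fill (SF.app (SF.app (SF.app O X) M) N).toSFA) →
      HasInf SFA.Red (C.fill R.toSFA)) := by
  have h : Relation.ReflTransGen SFA.SafeRed _ _ :=
    (hstep.safeRed_of_head hO hX hM hN).lift C.fill fun _ _ h => h.fill C
  refine ⟨?_, fun hi => ?_⟩
  · obtain ⟨n, g, h0, hn, hg⟩ := h.exists_seq
    exact ⟨n, g, h0, hn, fun i hi => ⟨(hg i hi).1, (hg i hi).hasInf⟩⟩
  · generalize C.fill R.toSFA = s at h
    induction h with
    | refl => exact hi
    | tail _ h ih => exact h.hasInf ih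
end

section
/- The translation ⟦·⟧_@ reflects strong normalisation: if ⟦M⟧_@ is strongly normalising with respect to →_{SF@}, then the SF-term M is strongly normalising with respect to →_SF. -/
/-- A term is strongly normalising w.r.t. a reduction relation `r` if it
admits no infinite reduction sequence. -/
def SN {α : Type*} (r : α → α → Prop) (a : α) : Prop :=
  ¬ ∃ f : ℕ → α, f 0 = a ∧ ∀ n, r (f n) (f (n + 1))

theorem SFA.Red.transGen_appL {a a' : SFA} (b : SFA) (h : Relation.TransGen SFA.Red a a') :
    Relation.TransGen SFA.Red (.app a b) (.app a' b) :=
  h.lift (fun x => SFA.app x b) fun _ _ => SFA.Red.appL b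

theorem SFA.Red.transGen_appR (a : SFA) {b b' : SFA} (h : Relation.TransGen SFA.Red b b') :
    Relation.TransGen SFA.Red (.app a b) (.app a b') :=
  h.lift (SFA.app a) fun _ _ => SFA.Red.appR a

/-- Three applications of `S0` reduce by currying to the contractum of `S`. -/
theorem SFA.Red.transGen_S (x y z : SFA) :
    Relation.TransGen SFA.Red (.app (.app (.app .S0 x) y) z) (.app (.app x z) (.app y z)) :=
  .head (.appL _ (.appL _ (.appS0 x))) (.head (.appL _ (.appS1 x y)) (.single (.appS2 x y z)))

/-- Three applications of `F0` reduce by currying to an `fRed`. -/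
theorem SFA.Red.transGen_F (x y z : SFA) :
    Relation.TransGen SFA.Red (.app (.app (.app .F0 x) y) z) (.fRed x y z) :=
  .head (.appL _ (.appL _ (.appF0 x))) (.head (.appL _ (.appF1 x y)) (.single (.appF2 x y z)))

/-- Factorisation of a translated compound factorable form. -/
theorem SFA.Red.transGen_fRed_of_factorable (P Q : SF) (y z : SFA) (h : (SF.app P Q).Factorable) :
    Relation.TransGen SFA.Red (.fRed (SF.app P Q).toSFA y z)
      (.app (.app z P.toSFA) Q.toSFA) := by
  match P, h with
  | .S, _ => exact .head (.fRed1 _ _ (.appS0 _)) (.single (.fRedS1 _ _ _))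
  | .F, _ => exact .head (.fRed1 _ _ (.appF0 _)) (.single (.fRedF1 _ _ _))
  | .app .S _, _ =>
    exact .head (.fRed1 _ _ (.appL _ (.appS0 _)))
      (.head (.fRed1 _ _ (.appS1 _ _)) (.single (.fRedS2 _ _ _ _)))
  | .app .F _, _ =>
    exact .head (.fRed1 _ _ (.appL _ (.appF0 _)))
      (.head (.fRed1 _ _ (.appF1 _ _)) (.single (.fRedF2 _ _ _ _)))

/-- Each step of SF-calculus is simulated by at least one step on the translations. -/
theorem SF.Red.transGen_toSFA {M N : SF} (h : SF.Red M N) :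
    Relation.TransGen SFA.Red M.toSFA N.toSFA := by
  induction h with
  | sred M N X => exact SFA.Red.transGen_S _ _ _
  | fatomS M N => exact (SFA.Red.transGen_F _ _ _).tail (.fRedS0 _ _)
  | fatomF M N => exact (SFA.Red.transGen_F _ _ _).tail (.fRedF0 _ _)
  | fcomp P Q M N h =>
    exact (SFA.Red.transGen_F _ _ _).trans (SFA.Red.transGen_fRed_of_factorable P Q _ _ h)
  | appL N _ ih => exact SFA.Red.transGen_appL _ ih
  | appR M _ ih => exact SFA.Red.transGen_appR _ ih

theorem sn_iff_acc {α : Type*} {r : α → α → Prop} {a : α} : SN r a ↔ Acc (flip r) a := by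
  rw [acc_iff_isEmpty_descending_chain, SN, isEmpty_subtype, not_exists]
  rfl

/-- The translation `⟦·⟧_@` reflects strong normalisation: if `⟦M⟧_@` is
strongly normalising w.r.t. `→_{SF@}`, then `M` is strongly normalising
w.r.t. `→_SF`. -/
theorem toSFA_reflects_SN {M : SF} (h : SN SFA.Red M.toSFA) :
    SN SF.Red M := by
  rw [sn_iff_acc] at h ⊢
  refine Subrelation.accessible ?_ (InvImage.accessible SF.toSFA h.transGen)
  intro N M hr
  exact Relation.transGen_swap.mpr (SF.Red.transGen_toSFA hr)
end
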